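/- For every prime p ≥ 5, the sum of a_p(A,B)⁴ over all pairs (A,B) ∈ (ℤ/pℤ)² with 4A³ + 27B² ≠ 0 equals (2p³ - 3p - 1)(p - 1). (Equivalently, since there are exactly p² - p such pairs, the fourth moment of a_p is 2p² - 3 - p⁻¹; this is Birch's formula M₄(a_p) = 2p² - 3 - p⁻¹.) -/

import Mathlib

section QuadraticCharSums

open Finset

theorem sum_eq_of_const_off {α : Type*} [Fintype α] [DecidableEq α] (s : Finset α) {g : α → ℤ}
    {r : ℤ} (h : ∀ t ∉ s, g t = r) :
    ∑ t : α, g t = ∑ t ∈ s, g t + (Fintype.card α - #s) * r := by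
  rw [← Finset.sum_add_sum_compl s g,
    Finset.sum_congr rfl fun t ht => h t (Finset.mem_compl.mp ht), Finset.sum_const,
    Finset.card_compl, nsmul_eq_mul, Nat.cast_sub (Finset.card_le_univ s)]

variable {F : Type*} [Field F] [Fintype F] [DecidableEq F]

theorem quadraticChar_mul_self_eq_one {a : F} (ha : a ≠ 0) :
    quadraticChar F a * quadraticChar F a = 1 := by
  rw [← sq, quadraticChar_sq_one ha]

theorem sum_quadraticChar_mul_self :
    ∑ u : F, quadraticChar F u * quadraticChar F u = Fintype.card F - 1 := by
  rw [← Finset.add_sum_erase _ _ (mem_univ (0 : F)),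
    Finset.sum_congr rfl fun u hu => quadraticChar_mul_self_eq_one (Finset.ne_of_mem_erase hu)]
  simp [Finset.card_erase_of_mem, Nat.cast_sub Fintype.card_pos]

/-- The sum of the quadratic character over the values of `u * (a * u + m)`. -/
theorem sum_quadraticChar_mul_linear (hF : ringChar F ≠ 2) (a m : F) :
    ∑ u : F, quadraticChar F u * quadraticChar F (a * u + m) =
      quadraticChar F a * ((if m = 0 then (Fintype.card F : ℤ) else 0) - 1) := by
  by_cases hm : m = 0
  · subst hm
    simp only [add_zero, map_mul, if_true]
    rw [← sum_quadraticChar_mul_self, Finset.mul_sum]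
    exact Finset.sum_congr rfl fun u _ => by ring
  · have key : ∀ u : F, quadraticChar F u * quadraticChar F (a * u + m) =
        quadraticChar F (a + m * u⁻¹) - if u = 0 then quadraticChar F a else 0 := by
      intro u
      by_cases hu : u = 0
      · simp [hu]
      · have h : a * u + m = u * (a + m * u⁻¹) := by field_simp
        rw [if_neg hu, h, map_mul, ← mul_assoc, quadraticChar_mul_self_eq_one hu]
        ring
    have h0 : ∑ u : F, quadraticChar F (a + m * u⁻¹) = 0 := by
      have hb : Function.Bijective fun u : F => a + m * u⁻¹ := by
        refine Finite.injective_iff_bijective.mp fun u v h => ?_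
        exact inv_injective (mul_left_cancel₀ hm (add_left_cancel h))
      rw [hb.sum_comp (fun u => quadraticChar F u), quadraticChar_sum_zero hF]
    simp only [key, Finset.sum_sub_distrib, h0, Finset.sum_ite_eq', mem_univ, if_true, if_neg hm]
    ring

/-- The quadratic character sum of `u * v * w * (a * u + b * v + c * w + d)`. -/
theorem sum_quadraticChar_mul_affine (hF : ringChar F ≠ 2) {a b c d : F}
    (ha : a ≠ 0) (hd : d ≠ 0) :
    ∑ u : F, ∑ v : F, ∑ w : F, quadraticChar F u * quadraticChar F v * quadraticChar F w *
        quadraticChar F (a * u + b * v + c * w + d) =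
      -(Fintype.card F * quadraticChar F (-(a * b * c))) := by
  have inner : ∀ u v : F, ∑ w : F, quadraticChar F u * quadraticChar F v * quadraticChar F w *
      quadraticChar F (a * u + b * v + c * w + d) =
      quadraticChar F c * Fintype.card F * (if u = -a⁻¹ * (b * v + d) then
        quadraticChar F u * quadraticChar F v else 0) -
      quadraticChar F c * (quadraticChar F u * quadraticChar F v) := by
    intro u v
    have h := sum_quadraticChar_mul_linear hF c (a * u + b * v + d)
    have hiff : a * u + b * v + d = 0 ↔ u = -a⁻¹ * (b * v + d) := by
      constructor
      · intro h
        field_simp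
        linear_combination h
      · rintro rfl
        field_simp
        ring
    calc _ = quadraticChar F u * quadraticChar F v * ∑ w : F, quadraticChar F w *
          quadraticChar F (c * w + (a * u + b * v + d)) := by
          rw [Finset.mul_sum]
          refine Finset.sum_congr rfl fun w _ => ?_
          rw [show c * w + (a * u + b * v + d) = a * u + b * v + c * w + d by ring]
          ring
      _ = _ := by
          rw [h]
          simp only [hiff]
          split_ifs <;> ring
  simp only [inner]
  rw [Finset.sum_comm]
  simp only [Finset.sum_sub_distrib, ← Finset.mul_sum, ← Finset.sum_mul,
    Finset.sum_ite_eq', mem_univ, if_true, quadraticChar_sum_zero hF]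
  have h := sum_quadraticChar_mul_linear hF b d
  rw [if_neg hd] at h
  have h2 : ∑ v : F, quadraticChar F (-a⁻¹ * (b * v + d)) * quadraticChar F v =
      quadraticChar F (-a⁻¹) * (quadraticChar F b * (0 - 1)) := by
    rw [← h, Finset.mul_sum]
    refine Finset.sum_congr rfl fun v _ => ?_
    rw [map_mul]
    ring
  have h3 : quadraticChar F (-(a * b * c)) =
      quadraticChar F (-a⁻¹) * quadraticChar F b * quadraticChar F c := by
    rw [show -(a * b * c) = (a * a) * (-a⁻¹ * b * c) by field_simp, map_mul, map_mul,
      quadraticChar_mul_self_eq_one ha, map_mul, map_mul, one_mul]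
  rw [h2, h3]
  ring

end QuadraticCharSums

section MonicCubics

open Finset

variable {F : Type*} [Field F]

/-- The value at `t` of the monic cubic with lower coefficients `c`. -/
def monicCubic (c : F × F × F) (t : F) : F := t ^ 3 + c.1 * t ^ 2 + c.2.1 * t + c.2.2

variable [Fintype F]

theorem monicCubic_interpolation_bijective {x y z : F} (hxy : x ≠ y) (hxz : x ≠ z)
    (hyz : y ≠ z) : Function.Bijective fun c : F × F × F =>
      (monicCubic c x, monicCubic c y, monicCubic c z) := by
  refine Finite.injective_iff_bijective.mp ?_
  rintro ⟨a, b, e⟩ ⟨a', b', e'⟩ h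
  simp only [monicCubic, Prod.mk.injEq] at h ⊢
  obtain ⟨hx, hy, hz⟩ := h
  have h1 : (a - a') * (x + y) + (b - b') = 0 :=
    mul_left_cancel₀ (sub_ne_zero.mpr hxy) (by linear_combination hx - hy)
  have h2 : (a - a') * (x + z) + (b - b') = 0 :=
    mul_left_cancel₀ (sub_ne_zero.mpr hxz) (by linear_combination hx - hz)
  have ha : a - a' = 0 :=
    mul_left_cancel₀ (sub_ne_zero.mpr hyz) (by linear_combination h1 - h2)
  have hb : b - b' = 0 := by linear_combination h1 - (x + y) * ha
  have he : e - e' = 0 := by linear_combination hx - x ^ 2 * ha - x * hb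
  exact ⟨sub_eq_zero.mp ha, sub_eq_zero.mp hb, sub_eq_zero.mp he⟩

theorem sum_monicCubic_three {x y z : F} (hxy : x ≠ y) (hxz : x ≠ z) (hyz : y ≠ z)
    (g : F → F → F → ℤ) :
    ∑ c : F × F × F, g (monicCubic c x) (monicCubic c y) (monicCubic c z) =
      ∑ u : F, ∑ v : F, ∑ w : F, g u v w := by
  have h := (monicCubic_interpolation_bijective hxy hxz hyz).sum_comp
    (fun t : F × F × F => g t.1 t.2.1 t.2.2)
  rw [h, Fintype.sum_prod_type]
  exact Finset.sum_congr rfl fun u _ => Fintype.sum_prod_type _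

theorem sum_monicCubic_one (x : F) (g : F → ℤ) :
    ∑ c : F × F × F, g (monicCubic c x) = (Fintype.card F : ℤ) ^ 2 * ∑ u : F, g u := by
  simp only [Fintype.sum_prod_type, monicCubic]
  have h : ∀ a b : F, ∑ e : F, g (x ^ 3 + a * x ^ 2 + b * x + e) = ∑ u : F, g u := fun a b =>
    Equiv.sum_comp (Equiv.addLeft (x ^ 3 + a * x ^ 2 + b * x)) g
  simp [h]
  ring

theorem monicCubic_shift_bijective (h3 : (3 : F) ≠ 0) :
    Function.Bijective fun t : F × F × F =>
      (3 * t.1, 3 * t.1 ^ 2 + t.2.1, t.1 ^ 3 + t.2.1 * t.1 + t.2.2) := by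
  refine Finite.injective_iff_bijective.mp ?_
  rintro ⟨s, a, b⟩ ⟨s', a', b'⟩ h
  simp only [Prod.mk.injEq] at h ⊢
  obtain ⟨h1, h2, h4⟩ := h
  obtain rfl := mul_left_cancel₀ h3 h1
  obtain rfl := add_left_cancel h2
  exact ⟨rfl, rfl, add_left_cancel h4⟩

variable [DecidableEq F]

theorem sum_monicCubic_two (hF : 2 < Fintype.card F) {x y : F} (hxy : x ≠ y)
    (g : F → F → ℤ) :
    ∑ c : F × F × F, g (monicCubic c x) (monicCubic c y) =
      Fintype.card F * ∑ u : F, ∑ v : F, g u v := by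
  obtain ⟨z, hz⟩ : ∃ z, z ∉ ({x, y} : Finset F) := by
    by_contra! h
    have h1 : Fintype.card F ≤ #({x, y} : Finset F) := Finset.card_le_card fun t _ => h t
    exact absurd (h1.trans Finset.card_le_two) (by omega)
  simp only [Finset.mem_insert, Finset.mem_singleton, not_or] at hz
  rw [sum_monicCubic_three hxy (Ne.symm hz.1) (Ne.symm hz.2) (fun u v _ => g u v)]
  simp [Finset.mul_sum]

/-- The correlation of the quadratic characters of the values of a monic cubic at four points,
summed over all monic cubics. -/
def cubicCorrelation (x y z w : F) : ℤ :=
  ∑ c : F × F × F, quadraticChar F (monicCubic c x) * quadraticChar F (monicCubic c y) *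
    quadraticChar F (monicCubic c z) * quadraticChar F (monicCubic c w)

theorem cubicCorrelation_swap_left (x y z w : F) :
    cubicCorrelation x y z w = cubicCorrelation y x z w :=
  Finset.sum_congr rfl fun _ _ => by ring

theorem cubicCorrelation_swap_middle (x y z w : F) :
    cubicCorrelation x y z w = cubicCorrelation x z y w :=
  Finset.sum_congr rfl fun _ _ => by ring

theorem cubicCorrelation_swap_right (x y z w : F) :
    cubicCorrelation x y z w = cubicCorrelation x y w z :=
  Finset.sum_congr rfl fun _ _ => by ring

theorem cubicCorrelation_self (x : F) :
    cubicCorrelation x x x x = (Fintype.card F : ℤ) ^ 2 * (Fintype.card F - 1) := by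
  rw [cubicCorrelation, sum_monicCubic_one x (fun u => quadraticChar F u * quadraticChar F u *
    quadraticChar F u * quadraticChar F u), ← sum_quadraticChar_mul_self]
  congr 1
  refine Finset.sum_congr rfl fun u _ => ?_
  by_cases hu : u = 0
  · simp [hu]
  · rw [quadraticChar_mul_self_eq_one hu, one_mul, quadraticChar_mul_self_eq_one hu]

theorem cubicCorrelation_pairs (hF : 2 < Fintype.card F) {x z : F} (hxz : x ≠ z) :
    cubicCorrelation x x z z = (Fintype.card F : ℤ) * (Fintype.card F - 1) ^ 2 := by
  rw [cubicCorrelation, sum_monicCubic_two hF hxz (fun u v => quadraticChar F u *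
    quadraticChar F u * quadraticChar F v * quadraticChar F v)]
  simp only [mul_assoc, ← Finset.mul_sum, sum_quadraticChar_mul_self]
  simp only [← mul_assoc, ← Finset.sum_mul, sum_quadraticChar_mul_self]
  ring

theorem cubicCorrelation_eq_zero (hF : ringChar F ≠ 2) (hq : 2 < Fintype.card F) {x z w : F}
    (hzw : z ≠ w) : cubicCorrelation x x z w = 0 := by
  have triple : ∀ s t : F, s ≠ t → cubicCorrelation s s s t = 0 := fun s t hst => by
    rw [cubicCorrelation, sum_monicCubic_two hq hst (fun u v => quadraticChar F u *
      quadraticChar F u * quadraticChar F u * quadraticChar F v)]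
    simp only [← Finset.mul_sum, quadraticChar_sum_zero hF, mul_zero, Finset.sum_const_zero]
  by_cases hxz : x = z
  · exact hxz ▸ triple x w (hxz ▸ hzw)
  by_cases hxw : x = w
  · subst hxw
    rw [cubicCorrelation_swap_right]
    exact triple x z hxz
  rw [cubicCorrelation, sum_monicCubic_three hxz hxw hzw (fun u v w => quadraticChar F u *
    quadraticChar F u * quadraticChar F v * quadraticChar F w)]
  simp only [← Finset.mul_sum, quadraticChar_sum_zero hF, mul_zero, Finset.sum_const_zero]

theorem cubicCorrelation_distinct (hF : ringChar F ≠ 2) {x y z w : F} (hxy : x ≠ y)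
    (hxz : x ≠ z) (hyz : y ≠ z) (hxw : x ≠ w) (hyw : y ≠ w) (hzw : z ≠ w) :
    cubicCorrelation x y z w = -(Fintype.card F : ℤ) := by
  have h1 := sub_ne_zero.mpr hxy
  have h2 := sub_ne_zero.mpr hxz
  have h3 := sub_ne_zero.mpr hyz
  have h4 := sub_ne_zero.mpr hxw.symm
  have h5 := sub_ne_zero.mpr hyw.symm
  have h6 := sub_ne_zero.mpr hzw.symm
  set a := (w - y) * (w - z) / ((x - y) * (x - z)) with ha
  set b := -((w - x) * (w - z) / ((x - y) * (y - z))) with hb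
  set e := (w - x) * (w - y) / ((x - z) * (y - z)) with he
  set d := (w - x) * (w - y) * (w - z) with hd
  have h : ∀ c : F × F × F, monicCubic c w =
      a * monicCubic c x + b * monicCubic c y + e * monicCubic c z + d := by
    intro c
    rw [ha, hb, he, hd]
    unfold monicCubic
    field_simp
    ring
  have ha0 : a ≠ 0 := div_ne_zero (mul_ne_zero h5 h6) (mul_ne_zero h1 h2)
  have hd0 : d ≠ 0 := mul_ne_zero (mul_ne_zero h4 h5) h6
  have hsq : quadraticChar F (-(a * b * e)) = 1 := by
    have : -(a * b * e) = (d / ((x - y) * (x - z) * (y - z))) ^ 2 := by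
      rw [ha, hb, he, hd]
      field_simp
    rw [this]
    exact quadraticChar_sq_one' (div_ne_zero hd0 (mul_ne_zero (mul_ne_zero h1 h2) h3))
  simp only [cubicCorrelation, h]
  rw [sum_monicCubic_three hxy hxz hyz (fun u v t => quadraticChar F u * quadraticChar F v *
    quadraticChar F t * quadraticChar F (a * u + b * v + e * t + d)),
    sum_quadraticChar_mul_affine hF ha0 hd0, hsq, mul_one]

theorem sum_cubicCorrelation_pair (hF : ringChar F ≠ 2) (hq : 2 < Fintype.card F) (x z : F) :
    ∑ w : F, cubicCorrelation x x z w = cubicCorrelation x x z z := by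
  refine Finset.sum_eq_single z (fun w _ hw => ?_) (by simp)
  exact cubicCorrelation_eq_zero hF hq hw.symm

theorem sum_cubicCorrelation_distinct (hF : ringChar F ≠ 2) (hq : 2 < Fintype.card F)
    {x y z : F} (hxy : x ≠ y) (hxz : x ≠ z) (hyz : y ≠ z) :
    ∑ w : F, cubicCorrelation x y z w = -(Fintype.card F * (Fintype.card F - 3) : ℤ) := by
  rw [sum_eq_of_const_off {x, y, z} (r := -(Fintype.card F : ℤ))]
  · have hx : cubicCorrelation x y z x = 0 := by
      rw [cubicCorrelation_swap_right, cubicCorrelation_swap_middle]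
      exact cubicCorrelation_eq_zero hF hq hyz
    have hy : cubicCorrelation x y z y = 0 := by
      rw [cubicCorrelation_swap_left, cubicCorrelation_swap_right, cubicCorrelation_swap_middle]
      exact cubicCorrelation_eq_zero hF hq hxz
    have hz : cubicCorrelation x y z z = 0 := by
      rw [cubicCorrelation_swap_middle, cubicCorrelation_swap_left, cubicCorrelation_swap_right,
        cubicCorrelation_swap_middle]
      exact cubicCorrelation_eq_zero hF hq hxy
    rw [Finset.card_eq_three.mpr ⟨x, y, z, hxy, hxz, hyz, rfl⟩,
      Finset.sum_insert (by simp [hxy, hxz]), Finset.sum_insert (by simp [hyz]),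
      Finset.sum_singleton, hx, hy, hz]
    push_cast
    ring
  · intro w hw
    simp only [Finset.mem_insert, Finset.mem_singleton, not_or] at hw
    exact cubicCorrelation_distinct hF hxy hxz hyz (Ne.symm hw.1) (Ne.symm hw.2.1)
      (Ne.symm hw.2.2)

theorem sum_cubicCorrelation (hF : ringChar F ≠ 2) (hq : 2 < Fintype.card F) :
    ∑ x : F, ∑ y : F, ∑ z : F, ∑ w : F, cubicCorrelation x y z w =
      (Fintype.card F : ℤ) ^ 2 * (Fintype.card F - 1) * (2 * Fintype.card F ^ 2 - 3) := by
  have hself : ∀ x : F, ∑ z : F, ∑ w : F, cubicCorrelation x x z w =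
      (Fintype.card F : ℤ) ^ 2 * (Fintype.card F - 1) +
        (Fintype.card F - 1) * (Fintype.card F * (Fintype.card F - 1) ^ 2) := by
    intro x
    simp only [sum_cubicCorrelation_pair hF hq]
    rw [sum_eq_of_const_off {x} fun z hz => cubicCorrelation_pairs hq
      (Ne.symm (Finset.notMem_singleton.mp hz)), Finset.sum_singleton, cubicCorrelation_self,
      Finset.card_singleton, Nat.cast_one]
  have hne : ∀ x y : F, x ≠ y → ∑ z : F, ∑ w : F, cubicCorrelation x y z w =
      2 * (Fintype.card F * (Fintype.card F - 1) ^ 2) -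
        (Fintype.card F - 2) * (Fintype.card F * (Fintype.card F - 3)) := by
    intro x y hxy
    rw [sum_eq_of_const_off {x, y} (r := -(Fintype.card F * (Fintype.card F - 3) : ℤ))]
    · have hx : ∑ w : F, cubicCorrelation x y x w =
          Fintype.card F * (Fintype.card F - 1) ^ 2 := by
        simp only [cubicCorrelation_swap_middle x y x]
        rw [sum_cubicCorrelation_pair hF hq, cubicCorrelation_pairs hq hxy]
      have hy : ∑ w : F, cubicCorrelation x y y w =
          Fintype.card F * (Fintype.card F - 1) ^ 2 := by
        simp only [cubicCorrelation_swap_left x y y, cubicCorrelation_swap_middle y x y]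
        rw [sum_cubicCorrelation_pair hF hq, cubicCorrelation_pairs hq hxy.symm]
      rw [Finset.card_pair hxy, Finset.sum_pair hxy, hx, hy]
      push_cast
      ring
    · intro z hz
      simp only [Finset.mem_insert, Finset.mem_singleton, not_or] at hz
      exact sum_cubicCorrelation_distinct hF hq hxy (Ne.symm hz.1) (Ne.symm hz.2)
  have hx : ∀ x : F, ∑ y : F, ∑ z : F, ∑ w : F, cubicCorrelation x y z w =
      (Fintype.card F : ℤ) * (Fintype.card F - 1) * (2 * Fintype.card F ^ 2 - 3) := by
    intro x
    rw [sum_eq_of_const_off {x} fun y hy => hne x y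
      (Ne.symm (Finset.notMem_singleton.mp hy)), Finset.sum_singleton, hself,
      Finset.card_singleton, Nat.cast_one]
    ring
  simp only [hx, Finset.sum_const, Finset.card_univ, nsmul_eq_mul]
  ring

/-- The fourth moment of the quadratic character sums of all monic cubics. -/
theorem sum_monicCubic_fourth_moment (hF : ringChar F ≠ 2) (hq : 2 < Fintype.card F) :
    ∑ c : F × F × F, (∑ x : F, quadraticChar F (monicCubic c x)) ^ 4 =
      (Fintype.card F : ℤ) ^ 2 * (Fintype.card F - 1) * (2 * Fintype.card F ^ 2 - 3) := by
  rw [← sum_cubicCorrelation hF hq]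
  simp only [cubicCorrelation]
  have h : ∀ g : F → ℤ, (∑ x, g x) ^ 4 = ∑ x, ∑ y, ∑ z, ∑ w, g x * g y * g z * g w := by
    intro g
    simp only [← Finset.mul_sum, ← Finset.sum_mul]
    ring
  simp only [h]
  rw [Finset.sum_comm]
  refine Finset.sum_congr rfl fun x _ => ?_
  rw [Finset.sum_comm]
  refine Finset.sum_congr rfl fun y _ => ?_
  rw [Finset.sum_comm]
  refine Finset.sum_congr rfl fun z _ => ?_
  rw [Finset.sum_comm]

/-- The fourth moment of the quadratic character sums of all monic cubics without quadratic
term. -/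
theorem sum_depressedCubic_fourth_moment (hF : ringChar F ≠ 2) (h3 : (3 : F) ≠ 0)
    (hq : 2 < Fintype.card F) :
    ∑ t : F × F, (∑ x : F, quadraticChar F (x ^ 3 + t.1 * x + t.2)) ^ 4 =
      (Fintype.card F : ℤ) * (Fintype.card F - 1) * (2 * Fintype.card F ^ 2 - 3) := by
  have h := sum_monicCubic_fourth_moment hF hq
  rw [← (monicCubic_shift_bijective h3).sum_comp, Fintype.sum_prod_type] at h
  have hshift : ∀ (s : F) (t : F × F), ∑ x : F, quadraticChar F (monicCubic
      (3 * s, 3 * s ^ 2 + t.1, s ^ 3 + t.1 * s + t.2) x) =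
      ∑ x : F, quadraticChar F (x ^ 3 + t.1 * x + t.2) := by
    intro s t
    rw [← Equiv.sum_comp (Equiv.addRight s)
      (fun x => quadraticChar F (x ^ 3 + t.1 * x + t.2))]
    refine Finset.sum_congr rfl fun x _ => congrArg _ ?_
    simp only [monicCubic, Equiv.coe_addRight]
    ring
  simp only [hshift, Finset.sum_const, Finset.card_univ, nsmul_eq_mul] at h
  have hpos : (Fintype.card F : ℤ) ≠ 0 := Nat.cast_ne_zero.mpr Fintype.card_ne_zero
  exact mul_left_cancel₀ hpos (by rw [h]; ring)

theorem sum_quadraticChar_singular_cubic (hF : ringChar F ≠ 2) (h3 : (3 : F) ≠ 0) (t : F) :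
    (∑ x : F, quadraticChar F (x ^ 3 + -3 * t ^ 2 * x + 2 * t ^ 3)) ^ 4 =
      if t = 0 then 0 else 1 := by
  have h : ∀ x : F, quadraticChar F (x ^ 3 + -3 * t ^ 2 * x + 2 * t ^ 3) =
      quadraticChar F (x + 2 * t) - if x = t then quadraticChar F (3 * t) else 0 := by
    intro x
    rw [show x ^ 3 + -3 * t ^ 2 * x + 2 * t ^ 3 = (x - t) * (x - t) * (x + 2 * t) by ring]
    by_cases hx : x = t
    · rw [hx, if_pos rfl, show t + 2 * t = 3 * t by ring]
      simp
    · rw [if_neg hx, map_mul, map_mul, quadraticChar_mul_self_eq_one (sub_ne_zero.mpr hx)]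
      ring
  have h0 : ∑ x : F, quadraticChar F (x + 2 * t) = 0 := by
    rw [← quadraticChar_sum_zero hF]
    exact Equiv.sum_comp (Equiv.addRight (2 * t)) (fun x => quadraticChar F x)
  simp only [h, Finset.sum_sub_distrib, h0, Finset.sum_ite_eq', mem_univ, if_true]
  split_ifs with ht
  · simp [ht]
  · have := quadraticChar_sq_one (mul_ne_zero h3 ht)
    linear_combination (quadraticChar F (3 * t) ^ 2 + 1) * this

theorem sum_singular_fourth_moment (hF : ringChar F ≠ 2) (h3 : (3 : F) ≠ 0) :
    ∑ t : F × F with ¬ 4 * t.1 ^ 3 + 27 * t.2 ^ 2 ≠ 0,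
      (∑ x : F, quadraticChar F (x ^ 3 + t.1 * x + t.2)) ^ 4 = (Fintype.card F : ℤ) - 1 := by
  have h2 : (2 : F) ≠ 0 := Ring.two_ne_zero hF
  have h := Finset.sum_nbij (s := (univ : Finset F))
    (t := univ.filter fun t : F × F => ¬ 4 * t.1 ^ 3 + 27 * t.2 ^ 2 ≠ 0)
    (f := fun t => if t = 0 then (0 : ℤ) else 1)
    (g := fun t => (∑ x : F, quadraticChar F (x ^ 3 + t.1 * x + t.2)) ^ 4)
    (fun t : F => (-3 * t ^ 2, 2 * t ^ 3)) ?_ ?_ ?_ ?_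
  · rw [← h, sum_eq_of_const_off {(0 : F)} fun t ht => if_neg (Finset.notMem_singleton.mp ht)]
    simp
  · intro t _
    simp only [Finset.mem_filter, mem_univ, true_and, not_not]
    ring
  · intro s _ t _ hst
    simp only [Prod.mk.injEq] at hst
    have hsq : s ^ 2 = t ^ 2 :=
      mul_left_cancel₀ (neg_ne_zero.mpr h3) hst.1
    have hcube : s ^ 3 = t ^ 3 := mul_left_cancel₀ h2 hst.2
    by_cases ht : t = 0
    · subst ht
      simpa using hsq
    · exact mul_left_cancel₀ (pow_ne_zero 2 ht) (by linear_combination hcube - s * hsq)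
  · rintro ⟨a, b⟩ hab
    simp only [Finset.coe_filter, mem_univ, true_and, not_not, Set.mem_ofPred_eq] at hab
    refine ⟨-3 * b / (2 * a), by simp, ?_⟩
    by_cases ha : a = 0
    · subst ha
      have hb : b = 0 := by
        have h27 : (27 : F) ≠ 0 := by
          rw [show (27 : F) = 3 ^ 3 by norm_num]
          exact pow_ne_zero 3 h3
        simpa [h27] using hab
      simp [hb]
    · simp only [Prod.mk.injEq]
      constructor
      · field_simp
        linear_combination -hab
      · field_simp
        linear_combination -b * hab
  · intro t _
    exact (sum_quadraticChar_singular_cubic hF h3 t).symm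

theorem card_weierstrass_affine (hF : ringChar F ≠ 2) (f : F → F) :
    (Nat.card {xy : F × F // xy.2 ^ 2 = f xy.1} : ℤ) =
      Fintype.card F + ∑ x : F, quadraticChar F (f x) := by
  have e : {xy : F × F // xy.2 ^ 2 = f xy.1} ≃ Σ x : F, {y : F // y ^ 2 = f x} :=
    { toFun := fun t => ⟨t.1.1, t.1.2, t.2⟩
      invFun := fun t => ⟨(t.1, t.2.1), t.2.2⟩
      left_inv := fun _ => rfl
      right_inv := fun _ => rfl }
  have h : ∀ x : F, (Fintype.card {y : F // y ^ 2 = f x} : ℤ) = quadraticChar F (f x) + 1 := by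
    intro x
    rw [← quadraticChar_card_sqrts hF (f x), Set.toFinset_card]
    rfl
  rw [Nat.card_congr e, Nat.card_eq_fintype_card, Fintype.card_sigma]
  push_cast
  simp only [h, Finset.sum_add_distrib, Finset.sum_const, Finset.card_univ, nsmul_eq_mul, mul_one]
  ring

end MonicCubics

/-- **Birch's formula** `M₄(a_p) = 2p² - 3 - p⁻¹` for a prime `p ≥ 5`: the sum of
`a_p(A,B)^4` over all pairs `(A,B) ∈ (ℤ/pℤ)²` with `4A³ + 27B² ≠ 0` equals
`2 * (p : ℤ) ^ 3 - 3 * (p : ℤ) - 1`, where `a_p(A,B) = p - #{(x,y) : y² = x³ + Ax + B}`. -/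
theorem birch_fourth_moment (p : ℕ) [Fact p.Prime] (hp5 : 5 ≤ p) :
    ∑ AB ∈ Finset.univ.filter
        (fun AB : ZMod p × ZMod p => 4 * AB.1 ^ 3 + 27 * AB.2 ^ 2 ≠ 0),
      ((p : ℤ) -
        (Nat.card {xy : ZMod p × ZMod p //
          xy.2 ^ 2 = xy.1 ^ 3 + AB.1 * xy.1 + AB.2} : ℤ)) ^ 4 =
      (2 * (p : ℤ) ^ 3 - 3 * (p : ℤ) - 1) * ((p : ℤ) - 1) := by
  have hcard : Fintype.card (ZMod p) = p := ZMod.card p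
  have hF : ringChar (ZMod p) ≠ 2 := by
    rw [ZMod.ringChar_zmod_n]
    omega
  have h3 : (3 : ZMod p) ≠ 0 := by
    intro h
    have h' : ((3 : ℕ) : ZMod p) = 0 := by exact_mod_cast h
    have := Nat.le_of_dvd (by norm_num) ((ZMod.natCast_eq_zero_iff 3 p).mp h')
    omega
  have hterm : ∀ t : ZMod p × ZMod p, ((p : ℤ) - (Nat.card {xy : ZMod p × ZMod p //
      xy.2 ^ 2 = xy.1 ^ 3 + t.1 * xy.1 + t.2} : ℤ)) ^ 4 =
      (∑ x : ZMod p, quadraticChar (ZMod p) (x ^ 3 + t.1 * x + t.2)) ^ 4 := by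
    intro t
    rw [card_weierstrass_affine hF fun x => x ^ 3 + t.1 * x + t.2, hcard]
    ring
  simp only [hterm]
  have hall := sum_depressedCubic_fourth_moment hF h3 (by omega)
  have hsing := sum_singular_fourth_moment hF h3
  rw [← Finset.sum_filter_add_sum_filter_not _
    (fun t : ZMod p × ZMod p => 4 * t.1 ^ 3 + 27 * t.2 ^ 2 ≠ 0), hsing, hcard] at hall
  linear_combination hall
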